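/- Suppose C is a measurable subset of (2^ℕ)^{d+1} and ℱ is a finite family of measurable functions from C to 2^ℕ such that F(x,·) has small fibres for every x ∈ (2^ℕ)^d and every F ∈ ℱ. If μ > 0 and γ > 0 then there is η > 0 such that for every ε > 0 there exists a ∈ C^1_μ for which the set {x ∈ (2^ℕ)^d : □_η(⋂_{F∈ℱ} F(x,·)^{−1}[a]) ≥ □_γ(C(x,·))} has product measure at least 1 − ε. -/

import Mathlib

open MeasureTheory Filter Set Topology
open scoped ENNReal

noncomputable section

/-- The Cantor space `2^ℕ`. -/
abbrev Cantor : Type := ℕ → Bool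

/-- The uniform product ("fair coin-flipping") probability measure on `2^ℕ`, realized as the
pushforward of Lebesgue measure on `[0,1)` under the binary-digit map. -/
noncomputable def cantorMeasure : Measure Cantor :=
  Measure.map (fun x : ℝ => fun n : ℕ => decide (⌊x * 2 ^ (n + 1)⌋ % 2 = 1))
    (volume.restrict (Set.Ico (0 : ℝ) 1))

/-- The basic cylinder `[a]` determined by a finite binary sequence `a`. -/
def cyl (a : List Bool) : Set Cantor := {x | ∀ i : Fin a.length, x i = a.get i}

/-- `[A] = ⋃ a ∈ A, [a]`. -/
def cylSet (A : Set (List Bool)) : Set Cantor := ⋃ a ∈ A, cyl a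

/-- The weight `2^(-|a|·r)` of a node `a`. -/
noncomputable def wt (r : ℝ) (a : List Bool) : ℝ≥0∞ := (2 : ℝ≥0∞) ^ (-(a.length : ℝ) * r)

/-- `Σ_{a ∈ A} 2^(-|a|·r)`. -/
noncomputable def wtSum (r : ℝ) (A : Set (List Bool)) : ℝ≥0∞ := ∑' a : A, wt r (a : List Bool)

/-- `A ∈ C^∞_ε`, i.e. `Σ_{a ∈ A} 2^(-|a|·r) ≤ ε`. -/
def memCinf (r ε : ℝ) (A : Set (List Bool)) : Prop := wtSum r A ≤ ENNReal.ofReal ε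

/-- The `r`-dimensional dyadic Hausdorff capacity `λ^r_∞`. -/
noncomputable def hcap (r : ℝ) (X : Set Cantor) : ℝ≥0∞ :=
  ⨅ (A : Set (List Bool)) (_ : X ⊆ cylSet A), wtSum r A

/-- `□_δ(X) = inf {λ^r_∞(X \ Z) : Z measurable, λ Z < δ}`. -/
noncomputable def sqcap (r δ : ℝ) (X : Set Cantor) : ℝ≥0∞ :=
  ⨅ (Z : Set Cantor) (_ : MeasurableSet Z) (_ : cantorMeasure Z < ENNReal.ofReal δ),
    hcap r (X \ Z)

open Classical in
theorem card_vanish_mul_pow {T : Type*} [Fintype T] [DecidableEq T] (N : ℕ) (S : Finset T) :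
    (Finset.univ.filter fun h : T → Fin (N + 1) => ∀ t ∈ S, h t = 0).card * (N + 1) ^ S.card =
      (N + 1) ^ Fintype.card T := by
  have h1 : (Finset.univ.filter fun h : T → Fin (N + 1) => ∀ t ∈ S, h t = 0) =
      Fintype.piFinset fun t => if t ∈ S then {0} else Finset.univ := by
    ext h
    simp only [Finset.mem_filter, Finset.mem_univ, true_and, Fintype.mem_piFinset]
    refine forall_congr' fun t => ?_
    by_cases ht : t ∈ S <;> simp [ht]
  have h2 : ((N + 1) ^ S.card : ℕ) = ∏ t : T, if t ∈ S then N + 1 else 1 := by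
    simp
  rw [h1, Fintype.card_piFinset, h2, ← Finset.prod_mul_distrib, ← Finset.card_univ,
    ← Finset.prod_const]
  refine Finset.prod_congr rfl fun t _ => ?_
  by_cases ht : t ∈ S <;> simp [ht]

open Classical in
theorem sum_measureReal_eq_integral_card {Y H : Type*} [MeasurableSpace Y] (ν : Measure Y)
    [IsFiniteMeasure ν] [Fintype H] (E : H → Set Y) (hE : ∀ h, MeasurableSet (E h)) :
    Integrable (fun y => ((Finset.univ.filter fun h => y ∈ E h).card : ℝ)) ν ∧
    ∑ h, ν.real (E h) = ∫ y, ((Finset.univ.filter fun h => y ∈ E h).card : ℝ) ∂ν := by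
  have hi : ∀ h, Integrable ((E h).indicator fun _ => (1 : ℝ)) ν := fun h =>
    (integrable_const 1).indicator (hE h)
  have e : (fun y => ((Finset.univ.filter fun h => y ∈ E h).card : ℝ)) =
      fun y => ∑ h, (E h).indicator (fun _ => (1 : ℝ)) y := by
    ext y; simp [Set.indicator_apply, Finset.sum_boole]
  rw [e]
  refine ⟨integrable_finsetSum _ fun h _ => hi h, ?_⟩
  rw [integral_finsetSum _ fun h _ => hi h]
  refine Finset.sum_congr rfl fun h _ => ?_
  rw [integral_indicator_const _ (hE h)]; simp

open Classical in
theorem sum_sq_sub_mean_le {Y H : Type*} [MeasurableSpace Y] (ν : Measure Y)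
    [IsProbabilityMeasure ν] [Fintype H] [Nonempty H] (E : H → Set Y)
    (hE : ∀ h, MeasurableSet (E h)) (K : Set (Y × Y)) (hK : MeasurableSet K)
    (hind : ∀ y z, (y, z) ∉ K →
      Fintype.card H * (Finset.univ.filter fun h => y ∈ E h ∧ z ∈ E h).card ≤
        (Finset.univ.filter fun h => y ∈ E h).card * (Finset.univ.filter fun h => z ∈ E h).card) :
    ∑ h, (ν.real (E h) - (∑ g, ν.real (E g)) / Fintype.card H) ^ 2 ≤
      (Fintype.card H : ℝ) * (ν.prod ν).real K := by
  set M : ℝ := (Fintype.card H : ℝ) with hM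
  have hMpos : 0 < M := by rw [hM]; exact_mod_cast Fintype.card_pos
  set s := ∑ g, ν.real (E g) with hs
  obtain ⟨i1, e1⟩ := sum_measureReal_eq_integral_card ν E hE
  obtain ⟨i2, e2⟩ := sum_measureReal_eq_integral_card (ν.prod ν) (fun h => E h ×ˢ E h)
    fun h => (hE h).prod (hE h)
  have e3 : ∑ h, ν.real (E h) ^ 2 = ∑ h, (ν.prod ν).real (E h ×ˢ E h) := by
    simp [measureReal_prod_prod, sq]
  have e4 : s ^ 2 = ∫ p : Y × Y, ((Finset.univ.filter fun h => p.1 ∈ E h).card : ℝ) *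
      ((Finset.univ.filter fun h => p.2 ∈ E h).card : ℝ) ∂(ν.prod ν) := by
    rw [integral_prod_mul (μ := ν) (ν := ν)
      (fun y => ((Finset.univ.filter fun h => y ∈ E h).card : ℝ))
      (fun y => ((Finset.univ.filter fun h => y ∈ E h).card : ℝ)), ← e1, sq]
  have i4 := i1.mul_prod i1
  have key : M * ∑ h, ν.real (E h) ^ 2 - s ^ 2 ≤ M ^ 2 * (ν.prod ν).real K := by
    rw [e3, e2, e4, ← integral_const_mul, ← integral_sub (i2.const_mul M) i4]
    have : M ^ 2 * (ν.prod ν).real K = ∫ p, K.indicator (fun _ => M ^ 2) p ∂(ν.prod ν) := by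
      rw [integral_indicator_const _ hK]; simp [mul_comm]
    rw [this]
    refine integral_mono ((i2.const_mul M).sub i4) ((integrable_const _).indicator hK) ?_
    rintro ⟨y, z⟩
    by_cases hp : (y, z) ∈ K
    · simp only [hp, indicator_of_mem]
      have : (0 : ℝ) ≤ ((Finset.univ.filter fun h => y ∈ E h).card : ℝ) *
        ((Finset.univ.filter fun h => z ∈ E h).card : ℝ) := by positivity
      refine (sub_le_self _ this).trans ?_
      rw [sq]
      gcongr
      rw [hM]
      exact_mod_cast Finset.card_le_univ _
    · simp only [hp, not_false_eq_true, indicator_of_notMem]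
      have := hind y z hp
      simp only [mem_prod]
      rw [sub_nonpos, hM]
      exact_mod_cast this
  have e5 : ∑ h, (ν.real (E h) - s / M) ^ 2 = ∑ h, ν.real (E h) ^ 2 - s ^ 2 / M := by
    have : ∀ h, (ν.real (E h) - s / M) ^ 2 =
        ν.real (E h) ^ 2 - 2 * (s / M) * ν.real (E h) + (s / M) ^ 2 := fun h => by ring
    simp only [this, Finset.sum_add_distrib, Finset.sum_sub_distrib, ← Finset.mul_sum, ← hs,
      Finset.sum_const, Finset.card_univ, nsmul_eq_mul, ← hM]
    field_simp; ring
  rw [e5]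
  have h6 : M * (∑ h, ν.real (E h) ^ 2 - s ^ 2 / M) ≤ M * (M * (ν.prod ν).real K) := by
    have : M * (∑ h, ν.real (E h) ^ 2 - s ^ 2 / M) = M * ∑ h, ν.real (E h) ^ 2 - s ^ 2 := by
      field_simp
    rw [this]; linarith
  exact le_of_mul_le_mul_left h6 hMpos

open Classical in
theorem card_filter_measureReal_lt_mul_le {Y T : Type*} [MeasurableSpace Y] (ν : Measure Y)
    [IsProbabilityMeasure ν] [Fintype T] [DecidableEq T] [MeasurableSpace T] [MeasurableSingletonClass T]
    (n N : ℕ) (φ : Fin n → Y → T) (hφ : ∀ j, Measurable (φ j)) (D : Set Y) (hD : MeasurableSet D)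
    (K : Set (Y × Y)) (hK : MeasurableSet K)
    (hKφ : ∀ y ∈ D, ∀ z ∈ D, ∀ i j, φ i y = φ j z → (y, z) ∈ K) (c : ℝ) (hc : 0 < c)
    (hcD : 2 * c * (N + 1) ^ n ≤ ν.real D) (E : (T → Fin (N + 1)) → Set Y)
    (hEdef : ∀ h, E h = {y | y ∈ D ∧ ∀ j, h (φ j y) = 0}) :
    ((Finset.univ.filter fun h : T → Fin (N + 1) =>
      ν.real (E h) < c).card : ℝ) * c ^ 2 ≤
      (Fintype.card (T → Fin (N + 1)) : ℝ) * (ν.prod ν).real K := by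
  have hE : ∀ h, MeasurableSet (E h) := by
    intro h
    have : E h = D ∩ ⋂ j, φ j ⁻¹' {t | h t = 0} := by ext; simp [hEdef]
    rw [this]
    exact hD.inter (MeasurableSet.iInter fun j => hφ j (Set.toFinite _).measurableSet)
  set S : Y → Finset T := fun y => Finset.univ.image fun j => φ j y with hS
  have hcard : Fintype.card (T → Fin (N + 1)) = (N + 1) ^ Fintype.card T := by simp
  have hmem : ∀ h y, y ∈ D → (y ∈ E h ↔ ∀ t ∈ S y, h t = 0) := by
    intro h y hy; simp [hEdef, hS, hy]
  have hone : ∀ y ∈ D, (Finset.univ.filter fun h => y ∈ E h).card * (N + 1) ^ (S y).card =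
      (N + 1) ^ Fintype.card T := by
    intro y hy
    rw [← card_vanish_mul_pow N (S y)]
    simp only [hmem _ y hy]
  have hmom := sum_sq_sub_mean_le ν E hE K hK ?_
  swap
  · intro y z hyz
    by_cases hy : y ∈ D
    swap
    · have : ∀ h, y ∉ E h := fun h hh => hy ((hEdef h ▸ hh : _ ∈ {y | _}).1)
      simp [this]
    by_cases hz : z ∈ D
    swap
    · have : ∀ h, z ∉ E h := fun h hh => hz ((hEdef h ▸ hh : _ ∈ {y | _}).1)
      simp [this]
    have hdisj : Disjoint (S y) (S z) := by
      rw [Finset.disjoint_left]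
      simp only [hS, Finset.mem_image, Finset.mem_univ, true_and]
      rintro t ⟨i, rfl⟩ ⟨j, hj⟩
      exact hyz (hKφ y hy z hz i j hj.symm)
    have htwo : (Finset.univ.filter fun h => y ∈ E h ∧ z ∈ E h).card *
        ((N + 1) ^ (S y).card * (N + 1) ^ (S z).card) = (N + 1) ^ Fintype.card T := by
      rw [← pow_add, ← Finset.card_union_of_disjoint hdisj, ← card_vanish_mul_pow N (S y ∪ S z)]
      simp only [hmem _ y hy, hmem _ z hz, Finset.mem_union, or_imp, forall_and]
    have hpos : 0 < (N + 1) ^ (S y).card * (N + 1) ^ (S z).card := by positivity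
    refine le_of_mul_le_mul_right (le_of_eq ?_) hpos
    rw [hcard, mul_assoc, htwo, mul_mul_mul_comm, hone y hy, hone z hz]
  set M : ℝ := (Fintype.card (T → Fin (N + 1)) : ℝ) with hM
  have hMpos : 0 < M := by rw [hM]; exact_mod_cast Fintype.card_pos
  obtain ⟨i1, e1⟩ := sum_measureReal_eq_integral_card ν E hE
  have hmean : 2 * c ≤ (∑ g, ν.real (E g)) / M := by
    rw [le_div_iff₀ hMpos, e1]
    have hq : (0 : ℝ) < (N + 1) ^ n := by positivity
    have h1 : 2 * c * M ≤ ∫ y, D.indicator (fun _ => M / (N + 1) ^ n) y ∂ν := by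
      rw [integral_indicator_const _ hD, smul_eq_mul, ← mul_div_assoc, le_div_iff₀ hq]
      nlinarith
    refine h1.trans (integral_mono ((integrable_const _).indicator hD) i1 fun y => ?_)
    by_cases hy : y ∈ D
    · simp only [hy, indicator_of_mem]
      rw [div_le_iff₀ hq, hM, hcard, ← hone y hy]
      push_cast
      gcongr
      · simp
      · exact Finset.card_image_le.trans (by simp)
    · simp [hy]
  calc _ = ∑ h ∈ Finset.univ.filter (fun h => ν.real (E h) < c), c ^ 2 := by simp
    _ ≤ ∑ h ∈ Finset.univ.filter (fun h => ν.real (E h) < c),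
        (ν.real (E h) - (∑ g, ν.real (E g)) / M) ^ 2 := by
      refine Finset.sum_le_sum fun h hh => ?_
      have := (Finset.mem_filter.1 hh).2
      nlinarith
    _ ≤ ∑ h, (ν.real (E h) - (∑ g, ν.real (E g)) / M) ^ 2 :=
      Finset.sum_le_sum_of_subset_of_nonneg (Finset.filter_subset _ _) fun _ _ _ => sq_nonneg _
    _ ≤ _ := hmom

/-- The restriction of a point of the Cantor space to its first `m` coordinates. -/
def cantorTrunc (m : ℕ) (w : Cantor) : Fin m → Bool := fun i => w i

theorem measurable_cantorTrunc (m : ℕ) : Measurable (cantorTrunc m) :=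
  measurable_pi_lambda _ fun i => measurable_pi_apply (i : ℕ)

theorem tendsto_measure_cantorTrunc_eq {α β : Type*} [MeasurableSpace α] [MeasurableSpace β]
    (P : Measure α) [IsProbabilityMeasure P] (ν : Measure β) [IsProbabilityMeasure ν]
    (C : Set (α × β)) (hC : MeasurableSet C) (f g : α × β → Cantor) (hf : Measurable f)
    (hg : Measurable g) (hsmall : ∀ x y, ν {w | (x, w) ∈ C ∧ g (x, w) = y} = 0) :
    (∀ m, MeasurableSet {p : α × β × β | (p.1, p.2.1) ∈ C ∧ (p.1, p.2.2) ∈ C ∧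
      cantorTrunc m (f (p.1, p.2.1)) = cantorTrunc m (g (p.1, p.2.2))}) ∧
    Tendsto (fun m => (P.prod (ν.prod ν)) {p : α × β × β | (p.1, p.2.1) ∈ C ∧ (p.1, p.2.2) ∈ C ∧
      cantorTrunc m (f (p.1, p.2.1)) = cantorTrunc m (g (p.1, p.2.2))}) atTop (𝓝 0) := by
  have m1 : Measurable fun p : α × β × β => (p.1, p.2.1) := by fun_prop
  have m2 : Measurable fun p : α × β × β => (p.1, p.2.2) := by fun_prop
  have hm : ∀ m, MeasurableSet {p : α × β × β | (p.1, p.2.1) ∈ C ∧ (p.1, p.2.2) ∈ C ∧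
      cantorTrunc m (f (p.1, p.2.1)) = cantorTrunc m (g (p.1, p.2.2))} := fun m =>
    (m1 hC).inter ((m2 hC).inter (measurableSet_eq_fun
      ((measurable_cantorTrunc m).comp (hf.comp m1))
      ((measurable_cantorTrunc m).comp (hg.comp m2))))
  refine ⟨hm, ?_⟩
  have hlim := tendsto_measure_iInter_atTop (μ := P.prod (ν.prod ν))
    (fun m => (hm m).nullMeasurableSet) (fun a b hab p hp => ⟨hp.1, hp.2.1, ?_⟩)
    ⟨0, measure_ne_top _ _⟩
  · have hnull : (P.prod (ν.prod ν)) (⋂ m, {p : α × β × β | (p.1, p.2.1) ∈ C ∧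
        (p.1, p.2.2) ∈ C ∧ cantorTrunc m (f (p.1, p.2.1)) = cantorTrunc m (g (p.1, p.2.2))}) =
        0 := by
      rw [Measure.measure_prod_null (MeasurableSet.iInter hm)]
      refine Filter.Eventually.of_forall fun x => ?_
      change (ν.prod ν) _ = 0
      rw [Measure.measure_prod_null (measurable_prodMk_left (MeasurableSet.iInter hm))]
      refine Filter.Eventually.of_forall fun y => measure_mono_null ?_ (hsmall x (f (x, y)))
      intro z hz
      simp only [mem_preimage, mem_iInter, mem_ofPred_eq] at hz ⊢
      refine ⟨(hz 0).2.1, funext fun k => ?_⟩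
      exact (congrFun (hz (k + 1)).2.2 ⟨k, k.lt_succ_self⟩).symm
    rw [hnull] at hlim
    exact hlim
  · funext i
    exact congrFun hp.2.2 ⟨i, i.2.trans_le hab⟩

open Classical in
theorem exists_coloring {α β ι : Type*} [MeasurableSpace α] [MeasurableSpace β]
    (P : Measure α) [IsProbabilityMeasure P] (ν : Measure β) [IsProbabilityMeasure ν]
    (C : Set (α × β)) (hC : MeasurableSet C) (n : ℕ) (G : Fin n → α × β → Cantor)
    (hG : ∀ j, Measurable (G j)) (hsmall : ∀ j x y, ν {w | (x, w) ∈ C ∧ G j (x, w) = y} = 0)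
    (I : Finset ι) (D : ι → Set (α × β)) (hD : ∀ i, MeasurableSet (D i)) (hDC : ∀ i, D i ⊆ C)
    (N : ℕ) (c : ℝ) (hc : 0 < c) (ε : ℝ) (hε : 0 < ε) :
    ∃ (m : ℕ) (h : (Fin m → Bool) → Fin (N + 1)),
      (Finset.univ.filter fun t => h t = 0).card * (N + 1) ≤ 2 * 2 ^ m ∧
      ∃ B : Set α, MeasurableSet B ∧ P B ≤ ENNReal.ofReal ε ∧ ∀ x ∉ B, ∀ i ∈ I,
        2 * c * (N + 1) ^ n ≤ ν.real {y | (x, y) ∈ D i} →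
        c ≤ ν.real {y | (x, y) ∈ D i ∧ ∀ j, h (cantorTrunc m (G j (x, y))) = 0} := by
  have hlim : Tendsto (fun m => ∑ i : Fin n, ∑ j : Fin n, (P.prod (ν.prod ν))
      {p : α × β × β | (p.1, p.2.1) ∈ C ∧ (p.1, p.2.2) ∈ C ∧
      cantorTrunc m (G i (p.1, p.2.1)) = cantorTrunc m (G j (p.1, p.2.2))}) atTop (𝓝 0) := by
    have : (0 : ℝ≥0∞) = ∑ i : Fin n, ∑ j : Fin n, 0 := by simp
    rw [this]
    exact tendsto_finsetSum _ fun i _ => tendsto_finsetSum _ fun j _ =>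
      (tendsto_measure_cantorTrunc_eq P ν C hC _ _ (hG i) (hG j) (hsmall j)).2
  set δ : ℝ := ε * c ^ 2 / (2 * (I.card + 1)) with hδ
  have hδpos : 0 < δ := by positivity
  obtain ⟨m, hm⟩ := (hlim.eventually (gt_mem_nhds (ENNReal.ofReal_pos.2 hδpos))).exists
  obtain ⟨K, hK, hKδ, hKmem⟩ : ∃ K : Set (α × β × β), MeasurableSet K ∧
      (P.prod (ν.prod ν)).real K ≤ δ ∧ ∀ x y z i j, (x, y) ∈ C → (x, z) ∈ C →
        cantorTrunc m (G i (x, y)) = cantorTrunc m (G j (x, z)) → (x, y, z) ∈ K := by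
    refine ⟨⋃ (i : Fin n) (j : Fin n), {p : α × β × β | (p.1, p.2.1) ∈ C ∧ (p.1, p.2.2) ∈ C ∧
      cantorTrunc m (G i (p.1, p.2.1)) = cantorTrunc m (G j (p.1, p.2.2))},
      MeasurableSet.iUnion fun i => MeasurableSet.iUnion fun j =>
        (tendsto_measure_cantorTrunc_eq P ν C hC _ _ (hG i) (hG j) (hsmall j)).1 m, ?_,
      fun x y z i j hy hz h => mem_iUnion₂.2 ⟨i, j, hy, hz, h⟩⟩
    refine ENNReal.toReal_le_of_le_ofReal hδpos.le (le_trans ?_ hm.le)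
    refine (measure_iUnion_fintype_le _ _).trans (Finset.sum_le_sum fun i _ => ?_)
    exact measure_iUnion_fintype_le _ _
  obtain ⟨E, hEdef⟩ : ∃ E : ι → ((Fin m → Bool) → Fin (N + 1)) → Set (α × β), ∀ i h, E i h =
    {p | p ∈ D i ∧ ∀ j, h (cantorTrunc m (G j p)) = 0} := ⟨fun i h => _, fun _ _ => rfl⟩
  have hE : ∀ i h, MeasurableSet (E i h) := by
    intro i h
    have : E i h = D i ∩ ⋂ j, (fun p => cantorTrunc m (G j p)) ⁻¹' {t | h t = 0} := by
      ext; simp [hEdef]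
    rw [this]
    exact (hD i).inter (MeasurableSet.iInter fun j =>
      ((measurable_cantorTrunc m).comp (hG j)) (Set.toFinite _).measurableSet)
  have hmeas : ∀ S : Set (α × β), MeasurableSet S →
      Measurable fun x => ν.real (Prod.mk x ⁻¹' S) := fun S hS =>
    (measurable_measure_prodMk_left hS).ennreal_toReal
  obtain ⟨B, hBdef⟩ : ∃ B : ι → ((Fin m → Bool) → Fin (N + 1)) → Set α, ∀ i h, B i h =
    {x | 2 * c * (N + 1) ^ n ≤ ν.real (Prod.mk x ⁻¹' D i)} ∩
      {x | ν.real (Prod.mk x ⁻¹' E i h) < c} := ⟨fun i h => _, fun _ _ => rfl⟩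
  have hB : ∀ i h, MeasurableSet (B i h) := by
    intro i h
    rw [hBdef]
    exact (measurableSet_le measurable_const (hmeas _ (hD i))).inter
      (measurableSet_lt (hmeas _ (hE i h)) measurable_const)
  set M : ℝ := (Fintype.card ((Fin m → Bool) → Fin (N + 1)) : ℝ) with hM
  have hMpos : 0 < M := by rw [hM]; exact_mod_cast Fintype.card_pos
  have hpt : ∀ i x, ((Finset.univ.filter fun h => x ∈ B i h).card : ℝ) ≤
      M / c ^ 2 * (ν.prod ν).real (Prod.mk x ⁻¹' K) := by
    intro i x
    by_cases hx : 2 * c * (N + 1) ^ n ≤ ν.real (Prod.mk x ⁻¹' D i)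
    · rw [div_mul_eq_mul_div, le_div_iff₀ (by positivity)]
      have := card_filter_measureReal_lt_mul_le ν n N (fun j y => cantorTrunc m (G j (x, y)))
        (fun j => (measurable_cantorTrunc m).comp ((hG j).comp measurable_prodMk_left))
        (Prod.mk x ⁻¹' D i) (measurable_prodMk_left (hD i)) (Prod.mk x ⁻¹' K)
        (measurable_prodMk_left hK) (fun y hy z hz a b hab =>
          hKmem x y z a b (hDC i hy) (hDC i hz) hab) c hc hx (fun h => Prod.mk x ⁻¹' E i h)
        fun h => by rw [hEdef]; rfl
      refine le_trans (le_of_eq ?_) this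
      congr 3
      ext h
      simp [hBdef, hx]
    · have : ∀ h, x ∉ B i h := fun h hh => by
        rw [hBdef] at hh
        exact hx hh.1
      simp only [this, Finset.filter_false, Finset.card_empty, Nat.cast_zero]
      positivity
  have hsum : ∀ i, ∑ h, P.real (B i h) ≤ M / c ^ 2 * δ := by
    intro i
    obtain ⟨i1, e1⟩ := sum_measureReal_eq_integral_card P (B i) (hB i)
    have i2 : Integrable (fun x => (ν.prod ν).real (Prod.mk x ⁻¹' K)) P :=
      Measure.integrable_measure_prodMk_left hK (measure_ne_top _ _)
    have e2 : ∫ x, (ν.prod ν).real (Prod.mk x ⁻¹' K) ∂P = (P.prod (ν.prod ν)).real K := by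
      simp only [measureReal_def]
      rw [integral_toReal (measurable_measure_prodMk_left hK).aemeasurable
        (Eventually.of_forall fun _ => measure_lt_top _ _), Measure.prod_apply hK]
    rw [e1]
    refine (integral_mono i1 (i2.const_mul (M / c ^ 2)) (hpt i)).trans ?_
    rw [integral_const_mul, e2]
    gcongr
  have hbad : ∑ h, P.real (⋃ i ∈ I, B i h) ≤ M * ε / 2 := by
    calc ∑ h, P.real (⋃ i ∈ I, B i h) ≤ ∑ h, ∑ i ∈ I, P.real (B i h) :=
          Finset.sum_le_sum fun h _ => measureReal_biUnion_finset_le _ _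
      _ = ∑ i ∈ I, ∑ h, P.real (B i h) := Finset.sum_comm
      _ ≤ ∑ i ∈ I, M / c ^ 2 * δ := Finset.sum_le_sum fun i _ => hsum i
      _ = I.card / (I.card + 1) * (M * ε / 2) := by
          rw [Finset.sum_const, nsmul_eq_mul, hδ]; field_simp
      _ ≤ 1 * (M * ε / 2) := by
          gcongr
          rw [div_le_one (by positivity)]; linarith
      _ = _ := one_mul _
  have hsize : ∑ h : (Fin m → Bool) → Fin (N + 1),
      ((Finset.univ.filter fun t => h t = 0).card : ℝ) * (N + 1) = 2 ^ m * M := by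
    rw [← Finset.sum_mul]
    have : ∑ h : (Fin m → Bool) → Fin (N + 1), (Finset.univ.filter fun t => h t = 0).card =
        ∑ t : Fin m → Bool, (Finset.univ.filter fun h : (Fin m → Bool) → Fin (N + 1) =>
          h t = 0).card := by
      simp only [Finset.card_filter]
      exact Finset.sum_comm
    have h2 : ∀ t : Fin m → Bool, (Finset.univ.filter fun h : (Fin m → Bool) → Fin (N + 1) =>
          h t = 0).card * (N + 1) = Fintype.card ((Fin m → Bool) → Fin (N + 1)) := by
      intro t
      have := card_vanish_mul_pow N ({t} : Finset (Fin m → Bool))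
      simpa using this
    have h3 : (∑ h : (Fin m → Bool) → Fin (N + 1), (Finset.univ.filter fun t => h t = 0).card) *
        (N + 1) = 2 ^ m * Fintype.card ((Fin m → Bool) → Fin (N + 1)) := by
      rw [this, Finset.sum_mul, Finset.sum_congr rfl fun t _ => h2 t]
      simp
    rw [hM]
    exact_mod_cast h3
  obtain ⟨h, -, hh⟩ := Finset.exists_le_of_sum_le
    (s := (Finset.univ : Finset ((Fin m → Bool) → Fin (N + 1))))
    (f := fun h => P.real (⋃ i ∈ I, B i h) / ε +
      ((Finset.univ.filter fun t => h t = 0).card : ℝ) * (N + 1) / (2 * 2 ^ m))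
    (g := fun _ => 1) Finset.univ_nonempty (by
      rw [Finset.sum_add_distrib, ← Finset.sum_div, ← Finset.sum_div, hsize, Finset.sum_const,
        Finset.card_univ, nsmul_eq_mul, ← hM]
      have : (∑ h, P.real (⋃ i ∈ I, B i h)) / ε ≤ M / 2 := by
        rw [div_le_iff₀ hε]; linarith
      have h2 : 2 ^ m * M / (2 * 2 ^ m) = M / 2 := by field_simp
      linarith)
  have hx1 : 0 ≤ P.real (⋃ i ∈ I, B i h) / ε := by positivity
  have hx2 : 0 ≤ ((Finset.univ.filter fun t => h t = 0).card : ℝ) * (N + 1) / (2 * 2 ^ m) := by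
    positivity
  refine ⟨m, h, ?_, ⋃ i ∈ I, B i h, ?_, ?_, ?_⟩
  · have : ((Finset.univ.filter fun t => h t = 0).card : ℝ) * (N + 1) / (2 * 2 ^ m) ≤ 1 := by
      linarith
    rw [div_le_one (by positivity)] at this
    exact_mod_cast this
  · exact I.measurableSet_biUnion fun i _ => hB i h
  · have : P.real (⋃ i ∈ I, B i h) / ε ≤ 1 := by linarith
    rw [div_le_one hε] at this
    rw [← ofReal_measureReal (measure_ne_top P _)]
    exact ENNReal.ofReal_le_ofReal this
  · intro x hx i hi hxi
    by_contra! hlt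
    refine hx (mem_biUnion hi ?_)
    rw [hBdef]
    refine ⟨hxi, ?_⟩
    rw [mem_ofPred_eq, hEdef]
    exact hlt

theorem measurable_binaryDigits :
    Measurable fun x : ℝ => fun n : ℕ => decide (⌊x * 2 ^ (n + 1)⌋ % 2 = 1) := by
  refine measurable_pi_lambda _ fun n => ?_
  have h1 : Measurable fun z : ℤ => decide (z % 2 = 1) := measurable_from_top
  exact h1.comp (Int.measurable_floor.comp (measurable_id.mul_const _))

instance isProbabilityMeasure_cantorMeasure : IsProbabilityMeasure cantorMeasure := by
  have : IsProbabilityMeasure (volume.restrict (Set.Ico (0 : ℝ) 1)) := ⟨by simp⟩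
  exact Measure.isProbabilityMeasure_map measurable_binaryDigits.aemeasurable

theorem measurableSet_cyl (a : List Bool) : MeasurableSet (cyl a) := by
  have : cyl a = ⋂ i : Fin a.length, (fun x : Cantor => x i) ⁻¹' {a.get i} := by
    ext; simp [cyl]
  rw [this]
  exact MeasurableSet.iInter fun i => measurable_pi_apply (i : ℕ) (measurableSet_singleton _)

theorem measurableSet_cylSet (A : Set (List Bool)) : MeasurableSet (cylSet A) :=
  MeasurableSet.biUnion A.to_countable fun a _ => measurableSet_cyl a

theorem floor_eq_of_binaryDigits_eq {x y : ℝ} (hx : x ∈ Set.Ico (0 : ℝ) 1)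
    (hy : y ∈ Set.Ico (0 : ℝ) 1) (k : ℕ)
    (h : ∀ n < k, decide (⌊x * 2 ^ (n + 1)⌋ % 2 = 1) = decide (⌊y * 2 ^ (n + 1)⌋ % 2 = 1)) :
    ⌊x * 2 ^ k⌋ = ⌊y * 2 ^ k⌋ := by
  have aux : ∀ z : ℝ, ∀ k : ℕ, ⌊z * 2 ^ (k + 1)⌋ / 2 = ⌊z * 2 ^ k⌋ := by
    intro z k
    have h1 := Int.floor_le (z * 2 ^ k)
    have h2 := Int.lt_floor_add_one (z * 2 ^ k)
    have h3 : 2 * ⌊z * 2 ^ k⌋ ≤ ⌊z * 2 ^ (k + 1)⌋ := by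
      rw [Int.le_floor]; push_cast; rw [pow_succ]; linarith
    have h4 : ⌊z * 2 ^ (k + 1)⌋ < 2 * ⌊z * 2 ^ k⌋ + 2 := by
      rw [Int.floor_lt]; push_cast; rw [pow_succ]; linarith
    omega
  induction k with
  | zero =>
    simp only [pow_zero, mul_one]
    rw [Int.floor_eq_zero_iff.2 hx, Int.floor_eq_zero_iff.2 hy]
  | succ k ih =>
    have h1 := ih fun n hn => h n (hn.trans k.lt_succ_self)
    have h2 := h k k.lt_succ_self
    have h3 := aux x k
    have h4 := aux y k
    rw [decide_eq_decide] at h2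
    omega

theorem cantorMeasure_cyl_le (a : List Bool) : cantorMeasure (cyl a) ≤ wt 1 a := by
  rw [cantorMeasure, Measure.map_apply measurable_binaryDigits (measurableSet_cyl a),
    Measure.restrict_apply (measurable_binaryDigits (measurableSet_cyl a))]
  set S := (fun x : ℝ => fun n : ℕ => decide (⌊x * 2 ^ (n + 1)⌋ % 2 = 1)) ⁻¹' cyl a ∩
    Set.Ico (0 : ℝ) 1 with hS
  rcases S.eq_empty_or_nonempty with h | ⟨y, hy⟩
  · simp [h]
  have hsub : S ⊆ Set.Ico ((⌊y * 2 ^ a.length⌋ : ℝ) / 2 ^ a.length)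
      ((⌊y * 2 ^ a.length⌋ + 1 : ℝ) / 2 ^ a.length) := by
    intro x hx
    have := floor_eq_of_binaryDigits_eq hx.2 hy.2 a.length fun n hn =>
      (hx.1 ⟨n, hn⟩).trans (hy.1 ⟨n, hn⟩).symm
    rw [← this, mem_Ico, div_le_iff₀ (by positivity), lt_div_iff₀ (by positivity)]
    exact ⟨Int.floor_le _, Int.lt_floor_add_one _⟩
  refine (measure_mono hsub).trans (le_of_eq ?_)
  rw [Real.volume_Ico, ← sub_div, add_sub_cancel_left, wt, mul_one, ENNReal.rpow_neg,
    ENNReal.rpow_natCast, one_div, ENNReal.ofReal_inv_of_pos (by positivity),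
    ENNReal.ofReal_pow (by norm_num)]
  simp

theorem cantorMeasure_cylSet_le {r : ℝ} (hr : r < 1) (A : Set (List Bool)) (k : ℕ) :
    cantorMeasure (cylSet {a ∈ A | k ≤ a.length}) ≤
      (2 : ℝ≥0∞) ^ (-((k : ℝ) * (1 - r))) * wtSum r A := by
  calc cantorMeasure (cylSet {a ∈ A | k ≤ a.length})
      ≤ ∑' a : {a ∈ A | k ≤ a.length}, cantorMeasure (cyl a) :=
        measure_biUnion_le _ (Set.to_countable _) _
    _ ≤ ∑' a : {a ∈ A | k ≤ a.length}, (2 : ℝ≥0∞) ^ (-((k : ℝ) * (1 - r))) * wt r a := by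
        refine ENNReal.tsum_le_tsum fun a => (cantorMeasure_cyl_le a).trans ?_
        rw [wt, wt, ← ENNReal.rpow_add _ _ (by norm_num) (by norm_num)]
        refine ENNReal.rpow_le_rpow_of_exponent_le (by norm_num) ?_
        have : (k : ℝ) ≤ ((a : List Bool).length : ℝ) := by exact_mod_cast a.2.2
        nlinarith
    _ = (2 : ℝ≥0∞) ^ (-((k : ℝ) * (1 - r))) * ∑' a : {a ∈ A | k ≤ a.length}, wt r a :=
        ENNReal.tsum_mul_left
    _ ≤ _ := by
        gcongr
        exact ENNReal.tsum_mono_subtype _ fun a ha => ha.1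

theorem sqcap_le_one (r δ : ℝ) (hδ : 0 < δ) (X : Set Cantor) : sqcap r δ X ≤ 1 := by
  refine (iInf₂_le ∅ MeasurableSet.empty).trans
    ((iInf_le _ (by simpa using hδ)).trans ((iInf₂_le {[]} ?_).trans ?_))
  · intro x _
    simp [cylSet, cyl]
  · simp [wtSum, wt]

theorem le_cantorMeasure_diff_of_wtSum_lt {r γ : ℝ} {X : Set Cantor} (hX : MeasurableSet X)
    {A : Set (List Bool)} (hA : wtSum r A < sqcap r γ X) :
    ENNReal.ofReal γ ≤ cantorMeasure (X \ cylSet A) := by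
  by_contra! h
  refine hA.not_ge ((iInf₂_le _ (hX.diff (measurableSet_cylSet A))).trans
    ((iInf_le _ h).trans (iInf₂_le A ?_)))
  rw [sdiff_sdiff_right_self]
  exact inter_subset_right

theorem memCinf_one_image_ofFn {m N : ℕ} {h : (Fin m → Bool) → Fin (N + 1)} {μ₀ : ℝ}
    (hN : 2 ≤ μ₀ * (N + 1))
    (hcard : (Finset.univ.filter fun t => h t = 0).card * (N + 1) ≤ 2 * 2 ^ m) :
    memCinf 1 μ₀ (List.ofFn '' {t | h t = 0}) := by
  rw [memCinf, wtSum, tsum_image (wt 1) List.ofFn_injective.injOn, tsum_fintype]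
  have e : ∀ t : {t | h t = 0}, wt 1 (List.ofFn (t : Fin m → Bool)) =
      ENNReal.ofReal ((2 ^ m : ℝ)⁻¹) := by
    intro t
    rw [wt, mul_one, ENNReal.rpow_neg, List.length_ofFn, ENNReal.rpow_natCast,
      ENNReal.ofReal_inv_of_pos (by positivity), ENNReal.ofReal_pow (by norm_num)]
    simp
  rw [Finset.sum_congr rfl fun t _ => e t, Finset.sum_const, nsmul_eq_mul,
    ← ENNReal.ofReal_natCast, ← ENNReal.ofReal_mul (by positivity)]
  refine ENNReal.ofReal_le_ofReal ?_
  have h1 : ((Finset.univ : Finset {t | h t = 0}).card : ℝ) * (N + 1) ≤ 2 * 2 ^ m := by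
    have : (Finset.univ : Finset {t | h t = 0}).card =
        (Finset.univ.filter fun t => h t = 0).card := by
      rw [Finset.card_univ]; exact Fintype.card_subtype _
    rw [this]; exact_mod_cast hcard
  rw [← div_eq_mul_inv, div_le_iff₀ (by positivity)]
  refine le_of_mul_le_mul_right (h1.trans ?_) (by positivity : (0 : ℝ) < N + 1)
  nlinarith [show (0 : ℝ) < 2 ^ m by positivity]

theorem mem_cylSet_image_ofFn {m : ℕ} {T : Set (Fin m → Bool)} {w : Cantor}
    (hw : cantorTrunc m w ∈ T) : w ∈ cylSet (List.ofFn '' T) := by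
  refine mem_biUnion (mem_image_of_mem _ hw) fun i => ?_
  simp [cantorTrunc]

theorem exists_pow_le {r : ℝ} (hr : r < 1) {c : ℝ} (hc : 0 < c) :
    ∃ k : ℕ, (2 : ℝ≥0∞) ^ (-((k : ℝ) * (1 - r))) ≤ ENNReal.ofReal c := by
  have hb : (2 : ℝ) ^ (-(1 - r)) < 1 :=
    Real.rpow_lt_one_of_one_lt_of_neg (by norm_num) (by linarith)
  obtain ⟨k, hk⟩ := exists_pow_lt_of_lt_one hc hb
  refine ⟨k, ?_⟩
  have : (2 : ℝ≥0∞) ^ (-((k : ℝ) * (1 - r))) = ENNReal.ofReal (((2 : ℝ) ^ (-(1 - r))) ^ k) := by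
    rw [← Real.rpow_natCast, ← Real.rpow_mul (by norm_num),
      ← ENNReal.ofReal_rpow_of_pos (by norm_num)]
    congr 1
    · simp
    · ring
  rw [this]
  exact ENNReal.ofReal_le_ofReal hk.le

theorem statement3 (r : ℝ) (hr0 : 0 < r) (hr1 : r < 1) (d : ℕ)
    (C : Set ((Fin d → Cantor) × Cantor)) (hC : MeasurableSet C)
    (n : ℕ) (F : Fin n → ((Fin d → Cantor) × Cantor) → Cantor)
    (hFmeas : ∀ j, Measurable (C.restrict (F j)))
    (hsmall : ∀ (j : Fin n) (x : Fin d → Cantor) (y : Cantor),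
      cantorMeasure {w : Cantor | (x, w) ∈ C ∧ F j (x, w) = y} = 0)
    (μ₀ γ : ℝ) (hμ : 0 < μ₀) (hγ : 0 < γ) :
    ∃ η : ℝ, 0 < η ∧ ∀ ε : ℝ, 0 < ε →
      ∃ a : Set (List Bool), memCinf 1 μ₀ a ∧
        1 - ENNReal.ofReal ε ≤
          (Measure.pi fun _ : Fin d => cantorMeasure)
            {x : Fin d → Cantor |
              sqcap r γ {w : Cantor | (x, w) ∈ C} ≤
                sqcap r η (⋂ j : Fin n,
                  {w : Cantor | (x, w) ∈ C ∧ F j (x, w) ∈ cylSet a})} := by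
  obtain ⟨N, hN⟩ := exists_nat_gt (2 / μ₀)
  have hN' : 2 ≤ μ₀ * (N + 1) := by
    rw [div_lt_iff₀ hμ] at hN; nlinarith
  set c : ℝ := γ / (2 * (N + 1) ^ n) with hc
  have hcpos : 0 < c := by positivity
  have hcγ : 2 * c * (N + 1) ^ n = γ := by rw [hc]; field_simp
  obtain ⟨k, hk⟩ := exists_pow_le hr1 (half_pos hcpos)
  refine ⟨c / 2, half_pos hcpos, fun ε hε => ?_⟩
  choose G hG hGF using fun j =>
    (MeasurableEmbedding.subtype_coe hC).exists_measurable_extend (hFmeas j) fun _ => inferInstance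
  have hGF' : ∀ j p, p ∈ C → G j p = F j p := fun j p hp => congrFun (hGF j) ⟨p, hp⟩
  have hGsmall : ∀ (j : Fin n) (x : Fin d → Cantor) (y : Cantor),
      cantorMeasure {w : Cantor | (x, w) ∈ C ∧ G j (x, w) = y} = 0 := fun j x y =>
    measure_mono_null (t := {w : Cantor | (x, w) ∈ C ∧ F j (x, w) = y})
      (fun w hw => ⟨hw.1, (hGF' j _ hw.1).symm.trans hw.2⟩) (hsmall j x y)
  have hfin : {B : Set (List Bool) | B ⊆ {l | l.length < k}}.Finite :=
    (List.finite_length_lt Bool k).finite_subsets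
  obtain ⟨m, h, hcard, B, hB, hPB, hgood⟩ := exists_coloring
    (Measure.pi fun _ : Fin d => cantorMeasure) cantorMeasure C hC n G hG hGsmall hfin.toFinset
    (fun U => C ∩ {p | p.2 ∉ cylSet U})
    (fun U => hC.inter (measurable_snd (measurableSet_cylSet U).compl))
    (fun U => inter_subset_left) N c hcpos ε hε
  refine ⟨List.ofFn '' {t | h t = 0}, memCinf_one_image_ofFn hN' hcard, ?_⟩
  calc 1 - ENNReal.ofReal ε ≤ 1 - (Measure.pi fun _ : Fin d => cantorMeasure) B := by gcongr
    _ = (Measure.pi fun _ : Fin d => cantorMeasure) Bᶜ := (prob_compl_eq_one_sub hB).symm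
    _ ≤ _ := measure_mono ?_
  intro x hx
  rw [mem_ofPred_eq]
  conv_rhs => unfold sqcap hcap
  refine le_iInf fun Z => le_iInf fun hZ => le_iInf fun hZη => le_iInf fun A =>
    le_iInf fun hcov => ?_
  by_contra! hlt
  have hA1 : wtSum r A ≤ 1 := hlt.le.trans (sqcap_le_one r γ hγ _)
  have hdiff := le_cantorMeasure_diff_of_wtSum_lt (measurable_prodMk_left hC) hlt
  set U := {a ∈ A | a.length < k} with hU
  have hc_le := hgood x hx U (hfin.mem_toFinset.2 fun a ha => ha.2) (by
    rw [hcγ]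
    refine (ENNReal.ofReal_le_iff_le_toReal (measure_ne_top _ _)).1
      (hdiff.trans (measure_mono fun y hy => ⟨hy.1, fun hyU => hy.2 ?_⟩))
    exact biUnion_subset_biUnion_left (fun a ha => ha.1) hyU)
  have hsub : {y | (x, y) ∈ C ∩ {p | p.2 ∉ cylSet U} ∧
      ∀ j, h (cantorTrunc m (G j (x, y))) = 0} ⊆ Z ∪ cylSet {a ∈ A | k ≤ a.length} := by
    rintro y ⟨⟨hyC, hyU⟩, hy⟩
    by_cases hyZ : y ∈ Z
    · exact Or.inl hyZ
    refine Or.inr ?_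
    have hmem : ∀ j, F j (x, y) ∈ cylSet (List.ofFn '' {t | h t = 0}) := fun j => by
      rw [← hGF' j _ hyC]
      exact mem_cylSet_image_ofFn (hy j)
    obtain ⟨a, haA, hya⟩ := mem_iUnion₂.1 (hcov ⟨mem_iInter.2 fun j => ⟨hyC, hmem j⟩, hyZ⟩)
    refine mem_biUnion ⟨haA, ?_⟩ hya
    by_contra! hak
    exact hyU (mem_biUnion (⟨haA, hak⟩ : a ∈ U) hya)
  have htail : cantorMeasure.real (cylSet {a ∈ A | k ≤ a.length}) ≤ c / 2 := by
    refine ENNReal.toReal_le_of_le_ofReal (half_pos hcpos).le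
      ((cantorMeasure_cylSet_le hr1 A k).trans (le_trans ?_ hk))
    exact mul_le_of_le_one_right' hA1
  have hZlt : cantorMeasure.real Z < c / 2 :=
    (ENNReal.lt_ofReal_iff_toReal_lt (measure_ne_top _ _)).1 hZη
  have := hc_le.trans
    ((measureReal_mono hsub (measure_ne_top _ _)).trans (measureReal_union_le _ _))
  linarith
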